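/- For integers n ≥ 10⁹ define a_n = 1/ln n, γ_n = e^{(ln n)^{1/2}}, b_n = e^{−γ_n}, δ_n = e^{−γ_n^{1/4}}, c_n = a_n − δ_n, d_n = a_n + δ_n, β_n = 1 − (ln n + (3/2) ln γ_n)/γ_n, and define Ω̃ on ℝ by Ω̃(x) = Σ_{n=10⁹}^{∞} ( |x−c_n|^{−β_n} χ_{(c_n−b_n, c_n)}(x) − |x−d_n|^{−β_n} χ_{(d_n−b_n, d_n)}(x) ) for x ∈ [0,1] and Ω̃(x) = 0 otherwise. Then the Hilbert transform of Ω̃, namely the function y ↦ lim_{ε→0⁺} (1/π) ∫_{|x−y|>ε} Ω̃(x)/(y−x) dx (defined at every y where the limit exists), is not in L¹(ℝ). -/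

import Mathlib

open MeasureTheory Metric
open scoped ENNReal

noncomputable section

/-- `a_n = 1/ln n`. -/
def aseq (n : ℕ) : ℝ := 1 / Real.log n

/-- `γ_n = e^{(ln n)^{1/2}}`. -/
def gseq (n : ℕ) : ℝ := Real.exp (Real.sqrt (Real.log n))

/-- `b_n = e^{-γ_n}`. -/
def bseq (n : ℕ) : ℝ := Real.exp (-gseq n)

/-- `δ_n = e^{-γ_n^{1/4}}`. -/
def dlt (n : ℕ) : ℝ := Real.exp (-(gseq n ^ ((1 : ℝ) / 4)))

/-- `c_n = a_n - δ_n`. -/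
def cseq (n : ℕ) : ℝ := aseq n - dlt n

/-- `d_n = a_n + δ_n`. -/
def dseq (n : ℕ) : ℝ := aseq n + dlt n

/-- `β_n = 1 - (ln n + (3/2) ln γ_n)/γ_n`. -/
def bet (n : ℕ) : ℝ := 1 - (Real.log n + (3 / 2) * Real.log (gseq n)) / gseq n

/-- The function `Ω̃` extended by zero outside `[0,1]`. -/
def Omt' (x : ℝ) : ℝ :=
  if x ∈ Set.Icc (0 : ℝ) 1 then
    ∑' n : ℕ, if 10 ^ 9 ≤ n then
      Set.indicator (Set.Ioo (cseq n - bseq n) (cseq n)) (fun t => |t - cseq n| ^ (-bet n)) x -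
      Set.indicator (Set.Ioo (dseq n - bseq n) (dseq n)) (fun t => |t - dseq n| ^ (-bet n)) x
    else 0
  else 0

open Filter Topology

/-- One-sided power singularity at `c`. -/
def bump (c b β : ℝ) : ℝ → ℝ := Set.indicator (Set.Ioo (c - b) c) fun t => |t - c| ^ (-β)

lemma bump_nonneg (c b β x : ℝ) : 0 ≤ bump c b β x :=
  Set.indicator_nonneg (fun _ _ => by positivity) x

lemma bump_eq_comp_sub (c b β x : ℝ) :
    bump c b β x = Set.indicator (Set.Ioo 0 b) (fun t : ℝ => t ^ (-β)) (c - x) := by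
  unfold bump
  by_cases h : x ∈ Set.Ioo (c - b) c
  · have h' : c - x ∈ Set.Ioo 0 b := ⟨by linarith [h.2], by linarith [h.1]⟩
    rw [Set.indicator_of_mem h, Set.indicator_of_mem h', abs_sub_comm, abs_of_pos h'.1]
  · have h' : c - x ∉ Set.Ioo 0 b := fun h' => h ⟨by linarith [h'.2], by linarith [h'.1]⟩
    rw [Set.indicator_of_notMem h, Set.indicator_of_notMem h']

lemma integrable_bump {c b β : ℝ} (hb : 0 < b) (hβ : β < 1) : Integrable (bump c b β) := by
  have h : Integrable (Set.indicator (Set.Ioo 0 b) (fun t : ℝ => t ^ (-β))) := by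
    rw [integrable_indicator_iff measurableSet_Ioo, intervalIntegral.integrableOn_Ioo_rpow_iff hb]
    linarith
  exact (h.comp_sub_left c).congr (ae_of_all _ fun x => (bump_eq_comp_sub c b β x).symm)

lemma integral_bump {c b β : ℝ} (hb : 0 < b) (hβ : β < 1) :
    ∫ x, bump c b β x = b ^ (1 - β) / (1 - β) := by
  simp_rw [bump_eq_comp_sub]
  rw [integral_sub_left_eq_self
      (fun x => Set.indicator (Set.Ioo 0 b) (fun t : ℝ => t ^ (-β)) x) volume c,
    integral_indicator measurableSet_Ioo, ← integral_Ioc_eq_integral_Ioo,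
    ← intervalIntegral.integral_of_le hb.le, integral_rpow (Or.inl (by linarith)),
    Real.zero_rpow (by linarith), sub_zero]
  ring_nf

/-- The square root of the logarithm, in terms of which all the sequences are expressed. -/
def rtl (n : ℕ) : ℝ := Real.sqrt (Real.log n)

lemma log_eq_rtl_sq (n : ℕ) : Real.log n = rtl n ^ 2 :=
  (Real.sq_sqrt (Real.log_natCast_nonneg n)).symm

lemma natCast_eq_exp_rtl_sq {n : ℕ} (hn : 0 < n) : (n : ℝ) = Real.exp (rtl n ^ 2) := by
  rw [← log_eq_rtl_sq, Real.exp_log (by exact_mod_cast hn)]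

lemma rtl_mono {m n : ℕ} (hm : 0 < m) (h : m ≤ n) : rtl m ≤ rtl n :=
  Real.sqrt_le_sqrt (Real.log_le_log (by exact_mod_cast hm) (by exact_mod_cast h))

lemma tendsto_rtl : Tendsto rtl atTop atTop :=
  Real.tendsto_sqrt_atTop.comp (Real.tendsto_log_atTop.comp tendsto_natCast_atTop_atTop)

lemma rtl_ge {n : ℕ} (hn : 10 ^ 9 ≤ n) : 4.4 ≤ rtl n := by
  apply Real.le_sqrt_of_sq_le
  have h1 : Real.log ((2 : ℝ) ^ 28) ≤ Real.log n := by
    apply Real.log_le_log (by norm_num)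
    have : ((10 ^ 9 : ℕ) : ℝ) ≤ n := by exact_mod_cast hn
    norm_num at this ⊢
    linarith
  rw [Real.log_pow] at h1
  have := Real.log_two_gt_d9
  norm_num at h1 ⊢
  linarith

lemma aseq_eq (n : ℕ) : aseq n = 1 / rtl n ^ 2 := by rw [aseq, log_eq_rtl_sq]

lemma bseq_eq (n : ℕ) : bseq n = Real.exp (-Real.exp (rtl n)) := rfl

lemma dlt_eq (n : ℕ) : dlt n = Real.exp (-Real.exp (rtl n / 4)) := by
  rw [dlt, gseq, ← Real.exp_mul, mul_one_div]; rfl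

lemma one_sub_bet (n : ℕ) :
    1 - bet n = (rtl n ^ 2 + 3 / 2 * rtl n) / Real.exp (rtl n) := by
  rw [bet, gseq, Real.log_exp, log_eq_rtl_sq]; simp [rtl, Real.sq_sqrt (Real.log_natCast_nonneg n)]

/-- The mass of the `n`-th bump. -/
def mass (n : ℕ) : ℝ :=
  Real.exp (-rtl n ^ 2) * Real.exp (-(rtl n / 2)) / (rtl n ^ 2 + 3 / 2 * rtl n)

lemma bet_lt_one {n : ℕ} (hn : 0 < rtl n) : bet n < 1 := by
  have h : 0 < 1 - bet n := by rw [one_sub_bet]; positivity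
  linarith

lemma bseq_pos (n : ℕ) : 0 < bseq n := Real.exp_pos _

lemma dlt_pos (n : ℕ) : 0 < dlt n := Real.exp_pos _

lemma integral_bump_eq_mass {n : ℕ} (hn : 0 < rtl n) (c : ℝ) :
    ∫ x, bump c (bseq n) (bet n) x = mass n := by
  rw [integral_bump (bseq_pos n) (bet_lt_one hn), one_sub_bet, bseq_eq, ← Real.exp_mul,
    neg_mul, mul_div_cancel₀ _ (Real.exp_pos _).ne', mass, ← Real.exp_add, div_div_eq_mul_div,
    ← Real.exp_add]
  ring_nf

lemma mass_le {n : ℕ} (hn : 10 ^ 9 ≤ n) : mass n ≤ 8 * (1 / (n * Real.log n ^ 2)) := by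
  have hs := rtl_ge hn
  have hs0 : 0 < rtl n := by linarith
  have hn0 : 0 < n := by omega
  rw [log_eq_rtl_sq, mass, Real.exp_neg (rtl n / 2), Real.exp_neg, ← natCast_eq_exp_rtl_sq hn0]
  have hn' : (0 : ℝ) < n := by exact_mod_cast hn0
  have h1 : rtl n ^ 2 / 8 ≤ Real.exp (rtl n / 2) := by
    have := Real.quadratic_le_exp_of_nonneg (x := rtl n / 2) (by positivity)
    nlinarith
  have h2 : (Real.exp (rtl n / 2))⁻¹ ≤ (rtl n ^ 2 / 8)⁻¹ := inv_anti₀ (by positivity) h1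
  calc (n : ℝ)⁻¹ * (Real.exp (rtl n / 2))⁻¹ / (rtl n ^ 2 + 3 / 2 * rtl n)
      ≤ (n : ℝ)⁻¹ * (rtl n ^ 2 / 8)⁻¹ / (rtl n ^ 2) := by gcongr; linarith
    _ = _ := by field_simp

lemma summable_one_div_mul_log_sq : Summable fun n : ℕ => 1 / ((n : ℝ) * Real.log n ^ 2) := by
  rw [← summable_nat_add_iff 2]
  have h := (summable_condensed_iff_of_nonneg
    (f := fun n : ℕ => 1 / (((n + 2 : ℕ) : ℝ) * Real.log ((n + 2 : ℕ) : ℝ) ^ 2))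
    (fun n => by positivity) (fun m n hm hmn => by
      have : (0 : ℝ) < m := by exact_mod_cast hm
      have h2 : 0 < Real.log ((m + 2 : ℕ) : ℝ) := Real.log_pos (by push_cast; linarith)
      have : ((m + 2 : ℕ) : ℝ) ≤ ((n + 2 : ℕ) : ℝ) := by exact_mod_cast Nat.add_le_add_right hmn 2
      gcongr)).1
  apply h
  have h2 := ((Real.summable_one_div_nat_pow (p := 2)).2 one_lt_two).mul_left (1 / Real.log 2 ^ 2)
  refine (summable_nat_add_iff 1).1 (Summable.of_nonneg_of_le (fun n => by positivity) (fun n => ?_)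
    ((summable_nat_add_iff 1).2 h2))
  have hl : 0 < Real.log 2 := Real.log_pos one_lt_two
  have h3 : ((n + 1 : ℕ) : ℝ) * Real.log 2 ≤ Real.log ((2 ^ (n + 1) + 2 : ℕ) : ℝ) := by
    rw [← Real.log_pow]
    exact Real.log_le_log (by positivity) (by push_cast; linarith)
  calc (2 : ℝ) ^ (n + 1) * (1 / (((2 ^ (n + 1) + 2 : ℕ) : ℝ) *
        Real.log ((2 ^ (n + 1) + 2 : ℕ) : ℝ) ^ 2))
      ≤ (2 : ℝ) ^ (n + 1) * (1 / ((2 : ℝ) ^ (n + 1) * (((n + 1 : ℕ) : ℝ) * Real.log 2) ^ 2)) := by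
        gcongr
        push_cast; linarith
    _ = _ := by field_simp

/-- The `n`-th dipole, set to zero below the starting index. -/
def dipole (n : ℕ) (x : ℝ) : ℝ :=
  if 10 ^ 9 ≤ n then bump (cseq n) (bseq n) (bet n) x - bump (dseq n) (bseq n) (bet n) x else 0

lemma Omt'_eq_indicator : Omt' = Set.indicator (Set.Icc 0 1) fun x => ∑' n, dipole n x := by
  ext x
  by_cases hx : x ∈ Set.Icc (0 : ℝ) 1
  · rw [Set.indicator_of_mem hx, Omt', if_pos hx]; rfl
  · rw [Set.indicator_of_notMem hx, Omt', if_neg hx]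

lemma integrable_dipole (n : ℕ) : Integrable (dipole n) := by
  unfold dipole
  split_ifs with hn
  · have hβ := bet_lt_one (n := n) (by linarith [rtl_ge hn])
    exact (integrable_bump (bseq_pos n) hβ).sub (integrable_bump (bseq_pos n) hβ)
  · exact integrable_zero _ _ _

lemma integral_norm_dipole_le (n : ℕ) :
    ∫ x, ‖dipole n x‖ ≤ 16 * (1 / ((n : ℝ) * Real.log n ^ 2)) := by
  by_cases hn : 10 ^ 9 ≤ n
  · have hs : 0 < rtl n := by linarith [rtl_ge hn]
    have hβ := bet_lt_one hs
    have hi := fun c => integrable_bump (c := c) (bseq_pos n) hβ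
    calc ∫ x, ‖dipole n x‖
        ≤ ∫ x, (bump (cseq n) (bseq n) (bet n) x + bump (dseq n) (bseq n) (bet n) x) := by
          refine integral_mono (integrable_dipole n).norm ((hi _).add (hi _)) fun x => ?_
          simp only [dipole, if_pos hn]
          refine (norm_sub_le _ _).trans_eq ?_
          rw [Real.norm_of_nonneg (bump_nonneg _ _ _ _), Real.norm_of_nonneg (bump_nonneg _ _ _ _)]
      _ = mass n + mass n := by
          rw [integral_add (hi _) (hi _), integral_bump_eq_mass hs, integral_bump_eq_mass hs]
      _ ≤ _ := by linarith [mass_le hn]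
  · simp only [dipole, if_neg hn, norm_zero, integral_zero]
    positivity

/-- A series of functions with summable `L¹` norms is integrable. -/
lemma integrable_tsum_of_summable_integral_norm {f : ℕ → ℝ → ℝ} (hf : ∀ n, Integrable (f n))
    (hs : Summable fun n => ∫ x, ‖f n x‖) : Integrable fun x => ∑' n, f n x := by
  refine ⟨AEStronglyMeasurable.tsum fun n => (hf n).1, ?_⟩
  calc ∫⁻ x, ‖∑' n, f n x‖ₑ ≤ ∫⁻ x, ∑' n, ‖f n x‖ₑ :=
        lintegral_mono fun x => enorm_tsum_le_tsum_enorm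
    _ = ∑' n, ∫⁻ x, ‖f n x‖ₑ := lintegral_tsum fun n => (hf n).1.enorm
    _ = ∑' n, ENNReal.ofReal (∫ x, ‖f n x‖) := by
        simp_rw [ofReal_integral_norm_eq_lintegral_enorm (hf _)]
    _ < ∞ := hs.tsum_ofReal_lt_top

lemma integrable_Omt' : Integrable Omt' := by
  rw [Omt'_eq_indicator]
  refine (integrable_tsum_of_summable_integral_norm integrable_dipole ?_).indicator
    measurableSet_Icc
  exact Summable.of_nonneg_of_le (fun n => integral_nonneg fun x => norm_nonneg _)
    integral_norm_dipole_le (summable_one_div_mul_log_sq.mul_left 16)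

lemma exp_quarter_ge {s : ℝ} (hs : 4.4 ≤ s) : 2 * Real.log s + 0.03 ≤ Real.exp (s / 4) := by
  have h1 : 3.004 ≤ Real.exp 1.1 := by
    have := Real.sum_le_exp_of_nonneg (x := 1.1) (by norm_num) 9
    refine le_trans ?_ this
    norm_num [Finset.sum_range_succ, Nat.factorial]
  have h2 : Real.exp (s / 4) = Real.exp 1.1 * Real.exp (s / 4 - 1.1) := by
    rw [← Real.exp_add]; ring_nf
  have h3 := Real.add_one_le_exp (s / 4 - 1.1)
  have h4 : Real.log s ≤ Real.log 4.4 + (s / 4.4 - 1) := by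
    have h := Real.log_le_sub_one_of_pos (x := s / 4.4) (by positivity)
    rw [Real.log_div (by linarith) (by norm_num)] at h
    linarith
  have h5 : Real.log 4.4 ≤ 1.4825 := by
    rw [Real.log_le_iff_le_exp (by norm_num)]
    have := Real.sum_le_exp_of_nonneg (x := 1.4825) (by norm_num) 10
    refine le_trans ?_ this
    norm_num [Finset.sum_range_succ, Nat.factorial]
  rw [h2]
  have h6 : 3.004 * (s / 4 - 1.1 + 1) ≤ Real.exp 1.1 * Real.exp (s / 4 - 1.1) := by
    gcongr
    linarith
  norm_num at *
  linarith

lemma bseq_lt_cseq {n : ℕ} (hn : 10 ^ 9 ≤ n) : bseq n < cseq n := by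
  have hs := rtl_ge hn
  have hs0 : 0 < rtl n := by linarith
  have key : ∀ t E : ℝ, 2 * Real.log (rtl n) + t ≤ E →
      Real.exp (-E) ≤ Real.exp (-t) * (1 / rtl n ^ 2) := fun t E h => by
    have h2 : Real.exp (-(2 * Real.log (rtl n))) = 1 / rtl n ^ 2 := by
      rw [Real.exp_neg, two_mul, Real.exp_add, Real.exp_log hs0]; field_simp
    rw [← h2, ← Real.exp_add]
    exact Real.exp_le_exp.2 (by linarith)
  have h1 := key _ _ (exp_quarter_ge hs)
  have h2 := key 4 (Real.exp (rtl n)) (by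
    have := Real.quadratic_le_exp_of_nonneg hs0.le
    have := Real.log_le_sub_one_of_pos hs0
    nlinarith)
  have h3 : Real.exp (-0.03) ≤ 0.975 := by
    rw [Real.exp_neg]
    have : (0.975 : ℝ)⁻¹ ≤ Real.exp 0.03 := by
      have := Real.quadratic_le_exp_of_nonneg (x := 0.03) (by norm_num)
      norm_num at *; linarith
    exact inv_le_of_inv_le₀ (by norm_num) this
  have h4 : Real.exp (-4) ≤ 0.02 := by
    rw [Real.exp_neg]
    have : (0.02 : ℝ)⁻¹ ≤ Real.exp 4 := by
      have := Real.sum_le_exp_of_nonneg (x := 4) (by norm_num) 8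
      refine le_trans ?_ this
      norm_num [Finset.sum_range_succ, Nat.factorial]
    exact inv_le_of_inv_le₀ (by norm_num) this
  have hp : 0 < 1 / rtl n ^ 2 := by positivity
  rw [cseq, aseq_eq, bseq_eq, dlt_eq]
  nlinarith

lemma aseq_antitone {m n : ℕ} (hm : 2 ≤ m) (h : m ≤ n) : aseq n ≤ aseq m := by
  have : (2 : ℝ) ≤ m := by exact_mod_cast hm
  exact one_div_le_one_div_of_le (Real.log_pos (by linarith))
    (Real.log_le_log (by linarith) (by exact_mod_cast h))

lemma dlt_antitone {m n : ℕ} (hm : 0 < m) (h : m ≤ n) : dlt n ≤ dlt m := by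
  rw [dlt_eq, dlt_eq]
  have := rtl_mono hm h
  gcongr

lemma tendsto_aseq : Tendsto aseq atTop (𝓝 0) := by
  have h := (Real.tendsto_log_atTop.comp
    (tendsto_natCast_atTop_atTop (R := ℝ))).inv_tendsto_atTop
  exact h.congr fun n => by simp [aseq]

/-- Consecutive `aseq` values are far apart compared with `dlt`. -/
lemma eventually_three_dlt_le : ∀ᶠ n in atTop, 3 * dlt n ≤ aseq n - aseq (n + 1) := by
  have h := (((Real.tendsto_exp_div_pow_atTop 2).comp
    (tendsto_rtl.atTop_div_const (r := 4) (by norm_num))).eventually_ge_atTop 500)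
  filter_upwards [h, tendsto_rtl.eventually_ge_atTop 1, eventually_ge_atTop 3] with n h1 h2 hn
  have hn3 : (3 : ℝ) ≤ n := by exact_mod_cast hn
  have hd : dlt n ≤ 1 / (24 * (n : ℝ) ^ 3) := by
    have e1 : 1 / (24 * (n : ℝ) ^ 3) = Real.exp (-(Real.log 24 + 3 * rtl n ^ 2)) := by
      have : Real.exp (3 * rtl n ^ 2) = (n : ℝ) ^ 3 := by
        rw [natCast_eq_exp_rtl_sq (n := n) (by omega), ← Real.exp_nat_mul]; norm_num
      rw [Real.exp_neg, Real.exp_add, Real.exp_log (by norm_num), this, one_div]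
    rw [e1, dlt_eq]
    apply Real.exp_le_exp.2
    have : Real.log 24 ≤ 24 - 1 := Real.log_le_sub_one_of_pos (by norm_num)
    simp only [Function.comp] at h1
    rw [le_div_iff₀ (by positivity)] at h1
    nlinarith
  have hl : 0 < Real.log n := Real.log_pos (by linarith)
  have hl1 : 0 < Real.log ((n : ℝ) + 1) := Real.log_pos (by linarith)
  have hgap : 1 / ((n : ℝ) + 1) ≤ Real.log (n + 1) - Real.log n := by
    have h := Real.one_sub_inv_le_log_of_pos (x := ((n : ℝ) + 1) / n) (by positivity)
    rw [Real.log_div (by positivity) (by positivity)] at h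
    refine le_trans (le_of_eq ?_) h
    field_simp
    ring
  have hle : Real.log n ≤ n := by linarith [Real.log_le_sub_one_of_pos (x := (n : ℝ)) (by linarith)]
  have hle1 : Real.log ((n : ℝ) + 1) ≤ 2 * n := by
    linarith [Real.log_le_sub_one_of_pos (x := (n : ℝ) + 1) (by linarith)]
  have e : aseq n - aseq (n + 1) =
      (Real.log (n + 1) - Real.log n) / (Real.log n * Real.log (n + 1)) := by
    rw [aseq, aseq]; push_cast; field_simp
  rw [e]
  calc 3 * dlt n ≤ 3 * (1 / (24 * (n : ℝ) ^ 3)) := by gcongr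
    _ ≤ (1 / ((n : ℝ) + 1)) / (n * (2 * n)) := by
      rw [div_div, mul_one_div, div_le_div_iff₀ (by positivity) (by positivity)]
      nlinarith [pow_pos (show (0:ℝ) < n by linarith) 2, pow_pos (show (0:ℝ) < n by linarith) 3]
    _ ≤ _ := by
      have : 0 ≤ Real.log (n + 1) - Real.log n := le_trans (by positivity) hgap
      gcongr

/-- The half-power of `bseq` is negligible compared with `mass * dlt`. -/
lemma eventually_sqrt_bseq_le (C : ℝ) :
    ∀ᶠ n in atTop, C * Real.exp (-(Real.exp (rtl n) / 2)) ≤ mass n * dlt n := by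
  have h := (((Real.tendsto_exp_div_pow_atTop 2).comp tendsto_rtl).eventually_ge_atTop
    (64 + 4 * |C|))
  filter_upwards [h, tendsto_rtl.eventually_ge_atTop 4] with n h1 h2
  set s := rtl n with hs
  simp only [Function.comp] at h1
  rw [← hs, le_div_iff₀ (by positivity)] at h1
  have hq : Real.exp (s / 4) ≤ Real.exp s / 8 := by
    have e : Real.exp s = Real.exp (s / 4) * Real.exp (3 * s / 4) := by
      rw [← Real.exp_add]; ring_nf
    have h8 : 8 ≤ Real.exp (3 * s / 4) := by
      have := Real.quadratic_le_exp_of_nonneg (x := 3 * s / 4) (by positivity)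
      nlinarith
    rw [e]
    nlinarith [Real.exp_pos (s / 4)]
  have hC : C ≤ Real.exp |C| := by linarith [Real.add_one_le_exp |C|, le_abs_self C]
  have hm : Real.exp (-(2 * s ^ 2 + 2 * s)) ≤ mass n := by
    rw [mass, ← hs, le_div_iff₀ (by positivity), ← Real.exp_add]
    have : s ^ 2 + 3 / 2 * s ≤ Real.exp (s ^ 2 + 3 / 2 * s) := by
      linarith [Real.add_one_le_exp (s ^ 2 + 3 / 2 * s)]
    calc _ ≤ Real.exp (-(2 * s ^ 2 + 2 * s)) * Real.exp (s ^ 2 + 3 / 2 * s) := by gcongr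
      _ = _ := by rw [← Real.exp_add]; ring_nf
  rw [dlt_eq, ← hs]
  calc C * Real.exp (-(Real.exp s / 2))
      ≤ Real.exp |C| * Real.exp (-(Real.exp s / 2)) := by gcongr
    _ ≤ Real.exp (-(2 * s ^ 2 + 2 * s)) * Real.exp (-Real.exp (s / 4)) := by
      rw [← Real.exp_add, ← Real.exp_add]
      apply Real.exp_le_exp.2
      have : |C| * 1 ≤ |C| * s ^ 2 := by gcongr; nlinarith
      have : 2 * s ≤ s ^ 2 := by nlinarith
      have : 0 ≤ |C| * s ^ 2 := by positivity
      nlinarith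
    _ ≤ _ := by gcongr

lemma eventually_le_mass_mul_exp :
    ∀ᶠ n : ℕ in atTop, 1 / (n : ℝ) ≤ mass n * Real.exp (rtl n) := by
  have h := (((Real.tendsto_exp_div_pow_atTop 2).comp
    (tendsto_rtl.atTop_div_const (r := 2) (by norm_num))).eventually_ge_atTop 10)
  filter_upwards [h, tendsto_rtl.eventually_ge_atTop 1, eventually_gt_atTop 0] with n h1 h2 hn
  simp only [Function.comp] at h1
  rw [le_div_iff₀ (by positivity)] at h1
  have e : mass n * Real.exp (rtl n) =
      (1 / (n : ℝ)) * (Real.exp (rtl n / 2) / (rtl n ^ 2 + 3 / 2 * rtl n)) := by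
    have : Real.exp (rtl n) = Real.exp (rtl n / 2) * Real.exp (rtl n / 2) := by
      rw [← Real.exp_add]; ring_nf
    rw [mass, natCast_eq_exp_rtl_sq hn, this, Real.exp_neg, Real.exp_neg]
    field_simp
  rw [e]
  refine le_mul_of_one_le_right (by positivity) ?_
  rw [one_le_div (by positivity)]
  nlinarith

lemma bump_eq_zero {c b β x : ℝ} (h : x ≤ c - b ∨ c ≤ x) : bump c b β x = 0 := by
  apply Set.indicator_of_notMem
  rintro ⟨h1, h2⟩
  rcases h with h | h <;> linarith

lemma bseq_le_dlt (n : ℕ) : bseq n ≤ dlt n := by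
  rw [bseq_eq, dlt_eq]
  have : rtl n / 4 ≤ rtl n := by have : 0 ≤ rtl n := Real.sqrt_nonneg _; linarith
  gcongr

lemma eventually_aseq_le_of_lt :
    ∀ᶠ n in atTop, ∀ k, 10 ^ 9 ≤ k → k < n → aseq n ≤ cseq k - bseq k := by
  obtain ⟨N, hN⟩ := eventually_atTop.1 eventually_three_dlt_le
  have hfin : ∀ᶠ n in atTop, ∀ k ∈ Finset.range N, 10 ^ 9 ≤ k → aseq n ≤ cseq k - bseq k := by
    rw [eventually_all_finset]
    intro k _
    by_cases hk : 10 ^ 9 ≤ k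
    · filter_upwards [tendsto_aseq.eventually_le_const (sub_pos.2 (bseq_lt_cseq hk))] with n hn _
        using hn
    · exact Eventually.of_forall fun n h => absurd h hk
  filter_upwards [hfin] with n hn k hk hkn
  by_cases hkN : k < N
  · exact hn k (Finset.mem_range.2 hkN) hk
  · have h1 := hN k (by omega)
    have h2 : aseq n ≤ aseq (k + 1) := aseq_antitone (by omega) hkn
    have := bseq_le_dlt k
    have := dlt_pos k
    rw [cseq]
    linarith

lemma eventually_dseq_le_of_gt :
    ∀ᶠ n in atTop, ∀ k, n < k → dseq k ≤ aseq n - 2 * dlt n := by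
  filter_upwards [eventually_three_dlt_le, eventually_ge_atTop 2] with n hn h2 k hk
  have h1 : aseq k ≤ aseq (n + 1) := aseq_antitone (by omega) hk
  have h3 : dlt k ≤ dlt n := dlt_antitone (by omega) hk.le
  rw [dseq]
  linarith

/-- For large `n`, only one bump of `Omt'` meets the interval `(a_n - 2δ_n, a_n)`. -/
lemma eventually_Omt'_eq_bump : ∀ᶠ n in atTop, ∀ x ∈ Set.Ioo (aseq n - 2 * dlt n) (aseq n),
    Omt' x = bump (cseq n) (bseq n) (bet n) x := by
  filter_upwards [eventually_aseq_le_of_lt, eventually_dseq_le_of_gt, eventually_three_dlt_le,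
    eventually_ge_atTop (10 ^ 9), tendsto_aseq.eventually_le_const one_pos] with n hlt hgt hgap hn h1
    x hx
  have hpos : ∀ k, 0 < dlt k ∧ 0 < bseq k ∧ bseq k ≤ dlt k :=
    fun k => ⟨dlt_pos k, bseq_pos k, bseq_le_dlt k⟩
  have hx01 : x ∈ Set.Icc (0 : ℝ) 1 := by
    have : 0 ≤ aseq (n + 1) := by
      rw [aseq_eq]; positivity
    exact ⟨by linarith [hx.1, hpos n], by linarith [hx.2]⟩
  rw [Omt'_eq_indicator, Set.indicator_of_mem hx01, tsum_eq_single n]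
  · rw [dipole, if_pos hn, bump_eq_zero (c := dseq n), sub_zero]
    left
    rw [dseq]
    linarith [hx.2, hpos n]
  · intro k hk
    rw [dipole]
    split_ifs with hk9
    · have hcd : cseq k ≤ dseq k := by rw [cseq, dseq]; linarith [hpos k]
      rcases lt_or_gt_of_ne hk with h | h
      · have := hlt k hk9 h
        rw [bump_eq_zero (Or.inl (by linarith [hx.2])),
          bump_eq_zero (Or.inl (by linarith [hx.2])), sub_zero]
      · have := hgt k h
        rw [bump_eq_zero (Or.inr (by linarith [hx.1])),
          bump_eq_zero (Or.inr (by linarith [hx.1])), sub_zero]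
    · rfl

/-- The square root of `bseq`. -/
def rootb (n : ℕ) : ℝ := Real.exp (-(Real.exp (rtl n) / 2))

lemma rootb_pos (n : ℕ) : 0 < rootb n := Real.exp_pos _

lemma bseq_le_rootb (n : ℕ) : bseq n ≤ rootb n := by
  rw [bseq_eq, rootb]
  exact Real.exp_le_exp.2 (by linarith [Real.exp_pos (rtl n)])

/-- The interval on which the Hilbert transform is large. -/
def window (n : ℕ) : Set ℝ := Set.Ioc (cseq n + bseq n) (cseq n + rootb n)

lemma eventually_rootb_le : ∀ᶠ n in atTop, 4 * rootb n ≤ dlt n := by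
  filter_upwards [eventually_sqrt_bseq_le 4, tendsto_rtl.eventually_ge_atTop 1] with n hn h1
  refine hn.trans (mul_le_of_le_one_left (dlt_pos n).le ?_)
  rw [mass, div_le_one (by positivity), ← Real.exp_add]
  refine (Real.exp_le_one_iff.2 ?_).trans ?_ <;> nlinarith

lemma integral_window (n : ℕ) :
    ∫ y in window n, (y - cseq n)⁻¹ = Real.exp (rtl n) / 2 := by
  have hle := bseq_le_rootb n
  rw [window, ← intervalIntegral.integral_of_le (by linarith),
    intervalIntegral.integral_comp_sub_right (fun y => y⁻¹), add_sub_cancel_left,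
    add_sub_cancel_left, integral_inv_of_pos (bseq_pos n) (rootb_pos n),
    Real.log_div (rootb_pos n).ne' (bseq_pos n).ne', rootb, bseq_eq, Real.log_exp, Real.log_exp]
  ring

lemma integrableOn_window (n : ℕ) : IntegrableOn (fun y => (y - cseq n)⁻¹) (window n) := by
  refine (ContinuousOn.integrableOn_Icc (a := cseq n + bseq n) (b := cseq n + rootb n) ?_).mono_set
    Set.Ioc_subset_Icc_self
  refine ContinuousOn.inv₀ (by fun_prop) fun y hy => ?_
  have := bseq_pos n
  exact ne_of_gt (by linarith [hy.1])

/-- Lower bound for the (absolutely convergent) Hilbert transform on the windows. -/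
lemma eventually_hilbert_window : ∀ᶠ n in atTop, ∀ y ∈ window n,
    (∀ x, |x - y| < bseq n → Omt' x = 0) ∧
    mass n / 4 * (y - cseq n)⁻¹ ≤ ∫ x, Omt' x / (y - x) := by
  set M := ∫ x, ‖Omt' x‖ with hM
  filter_upwards [eventually_Omt'_eq_bump, eventually_rootb_le, eventually_sqrt_bseq_le (8 * M),
    tendsto_rtl.eventually_ge_atTop 1] with n hO hr hm hs y hy
  have hb := bseq_pos n
  have hbr := bseq_le_rootb n
  have hδ := dlt_pos n
  have hc : cseq n = aseq n - dlt n := rfl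
  obtain ⟨hy1, hy2⟩ := hy
  have hyc : 0 < y - cseq n := by linarith
  have hzero : ∀ x, |x - y| < bseq n → Omt' x = 0 := fun x hx => by
    rw [abs_lt] at hx
    rw [hO x ⟨by linarith, by linarith⟩, bump_eq_zero (Or.inr (by linarith))]
  refine ⟨hzero, ?_⟩
  have hint : Integrable fun x => Omt' x / (y - x) := by
    refine (integrable_Omt'.norm.const_mul (bseq n)⁻¹).mono'
      (integrable_Omt'.1.mul (by fun_prop : Measurable fun x => (y - x)⁻¹).aestronglyMeasurable)
      (ae_of_all _ fun x => ?_)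
    by_cases hx : |x - y| < bseq n
    · simp [hzero x hx]
    · rw [norm_div, div_eq_inv_mul, Real.norm_eq_abs (y - x), abs_sub_comm]
      gcongr
      exact not_lt.1 hx
  set J := Set.Ioo (cseq n - bseq n) (cseq n) with hJ
  have hJm : MeasurableSet J := measurableSet_Ioo
  have hnear : mass n / (2 * (y - cseq n)) ≤ ∫ x in J, Omt' x / (y - x) := by
    have hβ := bet_lt_one (n := n) (by linarith)
    have hbi : Integrable (bump (cseq n) (bseq n) (bet n)) := integrable_bump hb hβ
    have e : mass n = ∫ x in J, bump (cseq n) (bseq n) (bet n) x := by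
      rw [← integral_bump_eq_mass (n := n) (by linarith) (cseq n)]
      refine (setIntegral_eq_integral_of_forall_compl_eq_zero fun x hx => ?_).symm
      exact Set.indicator_of_notMem hx _
    rw [e, ← integral_div]
    refine setIntegral_mono_on (hbi.integrableOn.div_const _) hint.integrableOn hJm fun x hx => ?_
    rw [hO x ⟨by linarith [hx.1], by linarith [hx.2]⟩]
    have := bump_nonneg (cseq n) (bseq n) (bet n) x
    gcongr
    · linarith [hx.2]
    · linarith [hx.1]
  have hfar : -(2 / dlt n * M) ≤ ∫ x in Jᶜ, Omt' x / (y - x) := by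
    have h1 : ‖∫ x in Jᶜ, Omt' x / (y - x)‖ ≤ ∫ x in Jᶜ, 2 / dlt n * ‖Omt' x‖ := by
      refine norm_integral_le_of_norm_le (integrable_Omt'.norm.const_mul _).integrableOn ?_
      rw [ae_restrict_iff' hJm.compl]
      refine ae_of_all _ fun x hx => ?_
      by_cases hx0 : x ∈ Set.Ioo (aseq n - 2 * dlt n) (aseq n)
      · rw [hO x hx0, bump, Set.indicator_of_notMem hx]; simp
      · have hd : dlt n / 2 ≤ |y - x| := by
          by_cases hxa : aseq n ≤ x
          · rw [abs_sub_comm]; exact le_trans (by linarith) (le_abs_self _)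
          · have : x ≤ aseq n - 2 * dlt n := by
              by_contra h
              exact hx0 ⟨not_le.1 h, not_le.1 hxa⟩
            exact le_trans (by linarith) (le_abs_self _)
        rw [norm_div, div_eq_inv_mul, Real.norm_eq_abs (y - x), ← inv_div]
        gcongr
    have h2 : ∫ x in Jᶜ, 2 / dlt n * ‖Omt' x‖ ≤ 2 / dlt n * M := by
      rw [integral_const_mul]
      gcongr
      exact setIntegral_le_integral integrable_Omt'.norm (ae_of_all _ fun x => norm_nonneg _)
    exact (abs_le.1 (h1.trans h2)).1
  rw [← integral_add_compl hJm hint]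
  have hM0 : 0 ≤ M := integral_nonneg fun x => norm_nonneg _
  have hfinal : 2 / dlt n * M ≤ mass n / (4 * (y - cseq n)) := by
    rw [div_mul_eq_mul_div, div_le_div_iff₀ hδ (by positivity)]
    calc 2 * M * (4 * (y - cseq n)) = 8 * M * (y - cseq n) := by ring
      _ ≤ 8 * M * rootb n := by gcongr; linarith
      _ ≤ _ := hm
  have e1 : mass n / 4 * (y - cseq n)⁻¹ = mass n / (4 * (y - cseq n)) := by field_simp
  have e2 : mass n / (2 * (y - cseq n)) = 2 * (mass n / (4 * (y - cseq n))) := by field_simp; ring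
  rw [e1]
  linarith

theorem Omt_hilbert_transform_not_integrable :
    ¬ ∃ H : ℝ → ℝ, Integrable H volume ∧
      ∀ y L : ℝ,
        Filter.Tendsto
          (fun ε : ℝ => (1 / Real.pi) * ∫ x in {x : ℝ | ε < |x - y|}, Omt' x / (y - x))
          (nhdsWithin 0 (Set.Ioi 0)) (nhds L) →
        H y = L := by
  rintro ⟨H, hH, hlim⟩
  obtain ⟨N, hN⟩ := eventually_atTop.1 (eventually_hilbert_window.and
    (eventually_rootb_le.and (eventually_dseq_le_of_gt.and eventually_le_mass_mul_exp)))
  have hval : ∀ n, N ≤ n → ∀ y ∈ window n, H y = 1 / Real.pi * ∫ x, Omt' x / (y - x) := by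
    intro n hn y hy
    refine hlim y _ (tendsto_const_nhds.congr' ?_)
    filter_upwards [Ioo_mem_nhdsGT (bseq_pos n)] with ε hε
    congr 1
    refine (setIntegral_eq_integral_of_forall_compl_eq_zero fun x hx => ?_).symm
    rw [((hN n hn).1 y hy).1 x ((not_lt.1 hx).trans_lt hε.2), zero_div]
  have hpi := Real.pi_pos
  have hint : ∀ n, N ≤ n → 1 / (8 * Real.pi) * (1 / (n : ℝ)) ≤ ∫ y in window n, H y := by
    intro n hn
    obtain ⟨hw, -, -, hm⟩ := hN n hn
    calc 1 / (8 * Real.pi) * (1 / (n : ℝ))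
        ≤ 1 / (8 * Real.pi) * (mass n * Real.exp (rtl n)) := by gcongr
      _ = ∫ y in window n, mass n / (4 * Real.pi) * (y - cseq n)⁻¹ := by
          rw [integral_const_mul, integral_window]; field_simp; ring
      _ ≤ _ := by
          refine setIntegral_mono_on ((integrableOn_window n).const_mul _) hH.integrableOn
            measurableSet_Ioc fun y hy => ?_
          rw [hval n hn y hy]
          calc mass n / (4 * Real.pi) * (y - cseq n)⁻¹
              = 1 / Real.pi * (mass n / 4 * (y - cseq n)⁻¹) := by field_simp
            _ ≤ _ := by gcongr; exact (hw y hy).2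
  have hsub : ∀ n, N ≤ n → ∀ y ∈ window n, aseq n - dlt n < y ∧ y < aseq n := by
    intro n hn y hy
    have hr := (hN n hn).2.1
    have hc : cseq n = aseq n - dlt n := rfl
    have := bseq_pos n
    have := dlt_pos n
    exact ⟨by linarith [hy.1], by linarith [hy.2]⟩
  have hdisj_lt : ∀ m n, N ≤ m → m < n → Disjoint (window m) (window n) := by
    intro m n hm hmn
    refine Set.disjoint_left.2 fun y hy hy' => ?_
    have h1 := hsub m hm y hy
    have h2 := hsub n (by omega) y hy'
    have h3 := (hN m hm).2.2.1 n hmn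
    have hd : dseq n = aseq n + dlt n := rfl
    linarith [dlt_pos m, dlt_pos n]
  have hdisj : Pairwise (Function.onFun Disjoint fun k => window (k + N)) := by
    intro i j hij
    rcases lt_or_gt_of_ne hij with h | h
    · exact hdisj_lt _ _ (by omega) (by omega)
    · exact (hdisj_lt _ _ (by omega) (by omega)).symm
  have hsum : Summable fun k : ℕ => ∫ y in window (k + N), H y :=
    (hasSum_integral_iUnion (fun _ => measurableSet_Ioc) hdisj hH.integrableOn).summable
  have hharm : Summable fun k : ℕ => 1 / (8 * Real.pi) * (1 / ((k + N : ℕ) : ℝ)) :=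
    Summable.of_nonneg_of_le (fun k => by positivity) (fun k => hint _ (by omega)) hsum
  rw [summable_mul_left_iff (by positivity)] at hharm
  exact Real.not_summable_one_div_natCast
    ((summable_nat_add_iff (f := fun n : ℕ => 1 / (n : ℝ)) N).1 hharm)
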